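/- Assume n ≥ 3, 0 ≤ a < (n−2)/2, a ≤ b < a+1 and p = 2n/(n−2+2(b−a)), and let ζ be the positive constant solution of (Z), i.e. ζ^{p−2} = (n−2a−2)^2/4. Then: (i) the kernel of 𝓛_0 has basis cos(ω_{a,p} t) and sin(ω_{a,p} t), where ω_{a,p} = (n−2a−2)√(p−2)/2; (ii) there exists an increasing sequence of positive constants {σ_i}_{i≥1}, divergent to ∞, such that for every i ≥ 1 the kernel of 𝓛_i has basis e^{−σ_i t} and e^{σ_i t}; indeed σ_i = √(λ_i − (p−2)(n−2a−2)^2/4), and for i ≥ 1 one has λ_i − (p−2)(n−2a−2)^2/4 ≥ 1. -/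

import Mathlib

open Real Set Metric Filter Function

noncomputable section

/-- The Euclidean Laplacian of `f` at `x`. -/
def lapE {n : ℕ} (f : EuclideanSpace ℝ (Fin n) → ℝ) (x : EuclideanSpace ℝ (Fin n)) : ℝ :=
  ∑ i : Fin n, iteratedFDeriv ℝ 2 f x ![EuclideanSpace.single i 1, EuclideanSpace.single i 1]

/-- The Laplace–Beltrami operator `Δ_θ` on the unit sphere `S^{n-1}`, computed via the
degree-zero homogeneous extension: for `θ` with `‖θ‖ = 1`, `sphLap f θ = Δ_θ f (θ)`. -/
def sphLap {n : ℕ} (f : EuclideanSpace ℝ (Fin n) → ℝ) (θ : EuclideanSpace ℝ (Fin n)) : ℝ :=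
  lapE (fun x => f (‖x‖⁻¹ • x)) θ

/-- Second derivative in the `t` variable. -/
def dtt (g : ℝ → ℝ) : ℝ → ℝ := deriv (deriv g)

/-- Dimension of the space of spherical harmonics on `S^{n-1}` of degree at most `d`. -/
def cumHarm (n d : ℕ) : ℕ := Nat.choose (n - 1 + d) (n - 1) + Nat.choose (n - 2 + d) (n - 1)

/-- The degree of the `i`-th spherical harmonic, eigenfunctions being listed with multiplicity. -/
def sphDeg (n i : ℕ) : ℕ := sInf {d | i < cumHarm n d}

/-- The `i`-th eigenvalue `λ_i` of `-Δ_θ` on `S^{n-1}`, listed in increasing order and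
repeated with multiplicity: `λ_i = d (n + d - 2)` where `d` is the degree of the `i`-th
spherical harmonic.  In particular `λ_0 = 0`, `λ_1 = ⋯ = λ_n = n - 1`, `λ_{n+1} = 2n`. -/
def sphEval (n i : ℕ) : ℝ := (sphDeg n i : ℝ) * ((n : ℝ) + (sphDeg n i : ℝ) - 2)

/-- The linearized operator `L_i = -d²/dt² + λ + (n-2)²/4 - ((n+2)/(n-2)) K(0) ξ^{4/(n-2)}`. -/
def Lop (n : ℕ) (K0 : ℝ) (ξ : ℝ → ℝ) (lam : ℝ) (h : ℝ → ℝ) : ℝ → ℝ :=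
  fun t => -dtt h t
    + (lam + ((n : ℝ) - 2) ^ 2 / 4
        - ((n : ℝ) + 2) / ((n : ℝ) - 2) * K0 * ξ t ^ ((4 : ℝ) / ((n : ℝ) - 2))) * h t

/-- The linearized operator `𝓛_i = -d²/dt² + λ + (n-2a-2)²/4 - (p-1) ζ^{p-2}` for the
Caffarelli-Kohn-Nirenberg equation. -/
def LopCKN (n : ℕ) (a p : ℝ) (ζ : ℝ → ℝ) (lam : ℝ) (h : ℝ → ℝ) : ℝ → ℝ :=
  fun t => -dtt h t + (lam + ((n : ℝ) - 2 * a - 2) ^ 2 / 4 - (p - 1) * ζ t ^ (p - 2)) * h t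

/-- `f, g` is a basis of the kernel of the second-order ODE operator `L` acting on `C²(ℝ)`. -/
def KerBasis (L : (ℝ → ℝ) → ℝ → ℝ) (f g : ℝ → ℝ) : Prop :=
  ContDiff ℝ 2 f ∧ ContDiff ℝ 2 g ∧ (∀ t, L f t = 0) ∧ (∀ t, L g t = 0) ∧
    LinearIndependent ℝ ![f, g] ∧
    ∀ h : ℝ → ℝ, ContDiff ℝ 2 h → (∀ t, L h t = 0) →
      ∃ c₁ c₂ : ℝ, ∀ t, h t = c₁ * f t + c₂ * g t

/-- `ξ` is a positive `T`-periodic solution of the Fowler equation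
`-ξ'' + ((n-2)²/4) ξ = K(0) ξ^{(n+2)/(n-2)}` on `ℝ`. -/
def FowlerXi (n : ℕ) (K0 : ℝ) (ξ : ℝ → ℝ) (T : ℝ) : Prop :=
  ContDiff ℝ 2 ξ ∧ (∀ t, 0 < ξ t) ∧ 0 < T ∧ Function.Periodic ξ T ∧
    ∀ t, -dtt ξ t + ((n : ℝ) - 2) ^ 2 / 4 * ξ t = K0 * ξ t ^ (((n : ℝ) + 2) / ((n : ℝ) - 2))

/-- `ζ` is a positive `T`-periodic solution of `-ζ'' + ((n-2a-2)²/4) ζ = ζ^{p-1}` on `ℝ`. -/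
def ZetaSol (n : ℕ) (a p : ℝ) (ζ : ℝ → ℝ) (T : ℝ) : Prop :=
  ContDiff ℝ 2 ζ ∧ (∀ t, 0 < ζ t) ∧ 0 < T ∧ Function.Periodic ζ T ∧
    ∀ t, -dtt ζ t + ((n : ℝ) - 2 * a - 2) ^ 2 / 4 * ζ t = ζ t ^ (p - 1)

/-- `ρ` is the increasing, divergent sequence of positive exponents such that, for every
`i ≥ 1`, the kernel of the linearized operator `L_i` at the Fowler solution `ξ` has a basis
`e^{-ρ_i t} p_i⁺(t)`, `e^{ρ_i t} p_i⁻(t)` with `p_i^±` smooth and `T`-periodic. -/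
def FowlerExponents (n : ℕ) (K0 : ℝ) (ξ : ℝ → ℝ) (T : ℝ) (ρ : ℕ → ℝ) : Prop :=
  (∀ i, 1 ≤ i → 0 < ρ i) ∧ (∀ i j, 1 ≤ i → i ≤ j → ρ i ≤ ρ j) ∧
    Tendsto ρ atTop atTop ∧
    ∀ i, 1 ≤ i → ∃ p₁ p₂ : ℝ → ℝ, ContDiff ℝ (⊤ : ℕ∞) p₁ ∧ ContDiff ℝ (⊤ : ℕ∞) p₂ ∧
      Function.Periodic p₁ T ∧ Function.Periodic p₂ T ∧
      KerBasis (Lop n K0 ξ (sphEval n i))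
        (fun t => Real.exp (-(ρ i) * t) * p₁ t) (fun t => Real.exp (ρ i * t) * p₂ t)

/-- Analogue of `FowlerExponents` for the CKN linearized operators `𝓛_i`. -/
def CKNExponents (n : ℕ) (a p : ℝ) (ζ : ℝ → ℝ) (T : ℝ) (σ : ℕ → ℝ) : Prop :=
  (∀ i, 1 ≤ i → 0 < σ i) ∧ (∀ i j, 1 ≤ i → i ≤ j → σ i ≤ σ j) ∧
    Tendsto σ atTop atTop ∧
    ∀ i, 1 ≤ i → ∃ q₁ q₂ : ℝ → ℝ, ContDiff ℝ (⊤ : ℕ∞) q₁ ∧ ContDiff ℝ (⊤ : ℕ∞) q₂ ∧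
      Function.Periodic q₁ T ∧ Function.Periodic q₂ T ∧
      KerBasis (LopCKN n a p ζ (sphEval n i))
        (fun t => Real.exp (-(σ i) * t) * q₁ t) (fun t => Real.exp (σ i * t) * q₂ t)

/-- The index set `{ Σ_{i≥1} nᵢ ρᵢ > 0 : nᵢ ∈ ℕ, finitely many nᵢ > 0 }`. -/
def IndexSet (ρ : ℕ → ℝ) : Set ℝ :=
  {s | 0 < s ∧ ∃ f : ℕ →₀ ℕ, (∀ i ∈ f.support, 1 ≤ i) ∧
    s = ∑ i ∈ f.support, (f i : ℝ) * ρ i}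

/-- `v` is a positive solution on `(t₀, ∞) × S^{n-1}` of the cylindrical conformal scalar
curvature equation `-v_tt - Δ_θ v + ((n-2)²/4) v = K(e^{-t}θ) v^{(n+2)/(n-2)}`. -/
def SolCyl (n : ℕ) (K : EuclideanSpace ℝ (Fin n) → ℝ)
    (v : ℝ → EuclideanSpace ℝ (Fin n) → ℝ) (t₀ : ℝ) : Prop :=
  (∀ t θ, t₀ < t → ‖θ‖ = 1 → 0 < v t θ) ∧
    ∀ (t : ℝ) (θ : EuclideanSpace ℝ (Fin n)), t₀ < t → ‖θ‖ = 1 →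
      -dtt (fun s => v s θ) t - sphLap (v t) θ + ((n : ℝ) - 2) ^ 2 / 4 * v t θ
        = K (Real.exp (-t) • θ) * v t θ ^ (((n : ℝ) + 2) / ((n : ℝ) - 2))

/-- `w` is a positive solution on `(t₀, ∞) × S^{n-1}` of the cylindrical CKN equation
`-w_tt - Δ_θ w + ((n-2a-2)²/4) w = w^{p-1}`. -/
def SolCylW (n : ℕ) (a p : ℝ) (w : ℝ → EuclideanSpace ℝ (Fin n) → ℝ) (t₀ : ℝ) : Prop :=
  (∀ t θ, t₀ < t → ‖θ‖ = 1 → 0 < w t θ) ∧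
    ∀ (t : ℝ) (θ : EuclideanSpace ℝ (Fin n)), t₀ < t → ‖θ‖ = 1 →
      -dtt (fun s => w s θ) t - sphLap (w t) θ + ((n : ℝ) - 2 * a - 2) ^ 2 / 4 * w t θ
        = w t θ ^ (p - 1)

/-- `v(t, θ) → ξ(t)` as `t → ∞`, uniformly for `θ ∈ S^{n-1}`. -/
def UnifConv {n : ℕ} (v : ℝ → EuclideanSpace ℝ (Fin n) → ℝ) (ξ : ℝ → ℝ) : Prop :=
  ∀ ε > 0, ∃ T : ℝ, ∀ t ≥ T, ∀ θ : EuclideanSpace ℝ (Fin n), ‖θ‖ = 1 → |v t θ - ξ t| < ε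

/-- The degree-zero homogeneous (in the sphere variable) representative of a function on the
cylinder `ℝ × S^{n-1}`. -/
def cylRep {n : ℕ} (F : ℝ → EuclideanSpace ℝ (Fin n) → ℝ) :
    ℝ × EuclideanSpace ℝ (Fin n) → ℝ :=
  fun pt => F pt.1 (‖pt.2‖⁻¹ • pt.2)

/-- The norm of the intrinsic gradient on the cylinder `ℝ × S^{n-1}` at `(t, θ)`. -/
def cylGrad {n : ℕ} (F : ℝ → EuclideanSpace ℝ (Fin n) → ℝ) (t : ℝ)
    (θ : EuclideanSpace ℝ (Fin n)) : ℝ :=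
  ‖fderiv ℝ (cylRep F) (t, θ)‖

/-- Membership in `C^{2,α}` of a region `s` of the cylinder. -/
def CylC2Holder {n : ℕ} (α : ℝ) (s : Set (ℝ × EuclideanSpace ℝ (Fin n)))
    (F : ℝ → EuclideanSpace ℝ (Fin n) → ℝ) : Prop :=
  ContDiffOn ℝ 2 (cylRep F) s ∧
    ∃ C : ℝ, ∀ p ∈ s, ∀ q ∈ s,
      ‖iteratedFDerivWithin ℝ 2 (cylRep F) s p - iteratedFDerivWithin ℝ 2 (cylRep F) s q‖
        ≤ C * ‖p - q‖ ^ α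

/-- A bounded smooth function on `(t₀, ∞) × S^{n-1}`. -/
def BddSmoothCyl {n : ℕ} (t₀ : ℝ) (c : ℝ → EuclideanSpace ℝ (Fin n) → ℝ) : Prop :=
  ContDiffOn ℝ (⊤ : ℕ∞) (cylRep c)
      ((Ioi t₀) ×ˢ {x : EuclideanSpace ℝ (Fin n) | x ≠ 0}) ∧
    ∃ M : ℝ, ∀ t θ, t₀ < t → ‖θ‖ = 1 → |c t θ| ≤ M

/-- The nonlinear operator `𝓜(f) = -f_tt - Δ_θ f + ((n-2)²/4) f - K f^{(n+2)/(n-2)}`. -/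
def Mop (n : ℕ) (K : EuclideanSpace ℝ (Fin n) → ℝ)
    (f : ℝ → EuclideanSpace ℝ (Fin n) → ℝ) (t : ℝ) (θ : EuclideanSpace ℝ (Fin n)) : ℝ :=
  -dtt (fun s => f s θ) t - sphLap (f t) θ + ((n : ℝ) - 2) ^ 2 / 4 * f t θ
    - K (Real.exp (-t) • θ) * f t θ ^ (((n : ℝ) + 2) / ((n : ℝ) - 2))

/-- The nonlinear operator `𝓝(f) = -f_tt - Δ_θ f + ((n-2a-2)²/4) f - f^{p-1}`. -/
def Nop (n : ℕ) (a p : ℝ)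
    (f : ℝ → EuclideanSpace ℝ (Fin n) → ℝ) (t : ℝ) (θ : EuclideanSpace ℝ (Fin n)) : ℝ :=
  -dtt (fun s => f s θ) t - sphLap (f t) θ + ((n : ℝ) - 2 * a - 2) ^ 2 / 4 * f t θ
    - f t θ ^ (p - 1)

/-- Constancy of the Wronskian. -/
theorem wr_const {k : ℝ} {y z : ℝ → ℝ} (hy : ContDiff ℝ 2 y) (hz : ContDiff ℝ 2 z)
    (ey : ∀ t, dtt y t = k * y t) (ez : ∀ t, dtt z t = k * z t) (t : ℝ) :
    y t * deriv z t - deriv y t * z t = y 0 * deriv z 0 - deriv y 0 * z 0 := by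
  have d1 : ∀ u : ℝ → ℝ, ContDiff ℝ 2 u → Differentiable ℝ u ∧ Differentiable ℝ (deriv u) := by
    intro u hu
    refine ⟨hu.differentiable (by norm_num), ?_⟩
    have : ContDiff ℝ (1 + 1) u := by norm_num; exact hu
    exact (contDiff_succ_iff_deriv.1 this).2.2.differentiable (by norm_num)
  obtain ⟨y1, y2⟩ := d1 y hy
  obtain ⟨z1, z2⟩ := d1 z hz
  have key : ∀ s, HasDerivAt (fun s => y s * deriv z s - deriv y s * z s) 0 s := by
    intro s
    have a1 := (y1 s).hasDerivAt
    have a2 : HasDerivAt (deriv y) (k * y s) s := by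
      rw [← ey s]; exact (y2 s).hasDerivAt
    have b1 := (z1 s).hasDerivAt
    have b2 : HasDerivAt (deriv z) (k * z s) s := by
      rw [← ez s]; exact (z2 s).hasDerivAt
    have := (a1.mul b2).sub (a2.mul b1)
    have e : deriv y s * deriv z s + y s * (k * z s) -
        (k * y s * z s + deriv y s * deriv z s) = 0 := by ring
    rw [e] at this
    exact this
  exact is_const_of_deriv_eq_zero (fun s => (key s).differentiableAt)
    (fun s => (key s).deriv) t 0

theorem kerBasis_of {L : (ℝ → ℝ) → ℝ → ℝ} {k : ℝ}
    (hL : ∀ h t, L h t = -dtt h t + k * h t) {f g : ℝ → ℝ}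
    (hf : ContDiff ℝ 2 f) (hg : ContDiff ℝ 2 g)
    (ef : ∀ t, dtt f t = k * f t) (eg : ∀ t, dtt g t = k * g t)
    (hW : f 0 * deriv g 0 - deriv f 0 * g 0 ≠ 0) : KerBasis L f g := by
  refine ⟨hf, hg, fun t => by rw [hL, ef]; ring, fun t => by rw [hL, eg]; ring, ?_, ?_⟩
  · rw [LinearIndependent.pair_iff]
    intro s t hst
    have f1 : Differentiable ℝ f := hf.differentiable (by norm_num)
    have g1 : Differentiable ℝ g := hg.differentiable (by norm_num)
    have e0 : s * f 0 + t * g 0 = 0 := by simpa using congrFun hst 0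
    have e1 : s * deriv f 0 + t * deriv g 0 = 0 := by
      have h := (((f1 0).hasDerivAt.const_mul s).add ((g1 0).hasDerivAt.const_mul t)).deriv
      have h2 : ((fun x => s * f x) + fun x => t * g x) = fun _ => (0 : ℝ) := by
        funext x; simpa using congrFun hst x
      rw [h2] at h
      simpa using h.symm
    constructor
    · have : s * (f 0 * deriv g 0 - deriv f 0 * g 0) = 0 := by
        linear_combination deriv g 0 * e0 - g 0 * e1
      exact (mul_eq_zero.1 this).resolve_right hW
    · have : t * (f 0 * deriv g 0 - deriv f 0 * g 0) = 0 := by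
        linear_combination f 0 * e1 - deriv f 0 * e0
      exact (mul_eq_zero.1 this).resolve_right hW
  · intro h hh hLh
    have eh : ∀ t, dtt h t = k * h t := fun t => by
      have := hLh t; rw [hL] at this; linarith
    refine ⟨(h 0 * deriv g 0 - deriv h 0 * g 0) / (f 0 * deriv g 0 - deriv f 0 * g 0),
      (f 0 * deriv h 0 - deriv f 0 * h 0) / (f 0 * deriv g 0 - deriv f 0 * g 0), fun t => ?_⟩
    have w1 := wr_const hf hg ef eg t
    have w2 := wr_const hh hg eh eg t
    have w3 := wr_const hf hh ef eh t
    have : h t * (f 0 * deriv g 0 - deriv f 0 * g 0) =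
        (h 0 * deriv g 0 - deriv h 0 * g 0) * f t + (f 0 * deriv h 0 - deriv f 0 * h 0) * g t := by
      rw [← w1, ← w2, ← w3]; ring
    rw [div_mul_eq_mul_div, div_mul_eq_mul_div, ← add_div, eq_div_iff hW, this]

theorem deriv_exp_lin (s : ℝ) :
    deriv (fun t : ℝ => Real.exp (s * t)) = fun t => s * Real.exp (s * t) := by
  funext t
  have := ((hasDerivAt_id t).const_mul s).exp.deriv
  simp only [id] at this
  rw [this]; ring

theorem dtt_exp_lin (s t : ℝ) :
    dtt (fun t : ℝ => Real.exp (s * t)) t = s ^ 2 * Real.exp (s * t) := by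
  unfold dtt
  rw [deriv_exp_lin, deriv_const_mul_field, deriv_exp_lin]; ring

theorem deriv_cos_lin (s : ℝ) :
    deriv (fun t : ℝ => Real.cos (s * t)) = fun t => -s * Real.sin (s * t) := by
  funext t
  have := ((hasDerivAt_id t).const_mul s).cos.deriv
  simp only [id] at this
  rw [this]; ring

theorem deriv_sin_lin (s : ℝ) :
    deriv (fun t : ℝ => Real.sin (s * t)) = fun t => s * Real.cos (s * t) := by
  funext t
  have := ((hasDerivAt_id t).const_mul s).sin.deriv
  simp only [id] at this
  rw [this]; ring

theorem dtt_cos_lin (s t : ℝ) :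
    dtt (fun t : ℝ => Real.cos (s * t)) t = -s ^ 2 * Real.cos (s * t) := by
  unfold dtt
  rw [deriv_cos_lin, deriv_const_mul_field, deriv_sin_lin]; ring

theorem dtt_sin_lin (s t : ℝ) :
    dtt (fun t : ℝ => Real.sin (s * t)) t = -s ^ 2 * Real.sin (s * t) := by
  unfold dtt
  rw [deriv_sin_lin, deriv_const_mul_field, deriv_cos_lin]; ring

theorem choose_lower (k d : ℕ) (hk : 1 ≤ k) : d + 1 ≤ Nat.choose (k + d) k := by
  induction d with
  | zero => simp
  | succ d ih =>
    obtain ⟨j, rfl⟩ : ∃ j, k = j + 1 := ⟨k - 1, by omega⟩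
    have e : j + 1 + (d + 1) = (j + 1 + d) + 1 := by ring
    rw [e, Nat.choose_succ_succ']
    have : 0 < Nat.choose (j + 1 + d) j := Nat.choose_pos (by omega)
    omega

theorem cumHarm_lower (n d : ℕ) (hn : 3 ≤ n) : d < cumHarm n d := by
  have := choose_lower (n - 1) d (by omega)
  unfold cumHarm; omega

theorem cumHarm_mono (n : ℕ) {d e : ℕ} (h : d ≤ e) : cumHarm n d ≤ cumHarm n e := by
  unfold cumHarm
  exact Nat.add_le_add (Nat.choose_le_choose _ (by omega)) (Nat.choose_le_choose _ (by omega))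

theorem cumHarm_zero (n : ℕ) (hn : 3 ≤ n) : cumHarm n 0 = 1 := by
  unfold cumHarm
  simp [Nat.choose_eq_zero_of_lt (show n - 2 < n - 1 by omega)]

theorem sphDeg_spec (n i : ℕ) (hn : 3 ≤ n) : i < cumHarm n (sphDeg n i) :=
  Nat.sInf_mem (s := {d | i < cumHarm n d}) ⟨i, cumHarm_lower n i hn⟩

theorem sphDeg_zero (n : ℕ) (hn : 3 ≤ n) : sphDeg n 0 = 0 := by
  have : sphDeg n 0 ≤ 0 := Nat.sInf_le (by simp [cumHarm_zero n hn])
  omega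

theorem sphDeg_ge (n i D : ℕ) (hn : 3 ≤ n) (h : cumHarm n D ≤ i) : D + 1 ≤ sphDeg n i := by
  by_contra hc
  have h1 := sphDeg_spec n i hn
  have h2 := cumHarm_mono n (show sphDeg n i ≤ D by omega)
  omega

theorem sphDeg_mono (n : ℕ) (hn : 3 ≤ n) {i j : ℕ} (h : i ≤ j) : sphDeg n i ≤ sphDeg n j :=
  Nat.sInf_le (lt_of_le_of_lt h (sphDeg_spec n j hn))

/-- (Lemma B.1: kernels of `𝓛_i` at the constant solution of the CKN
Fowler equation.) -/
theorem statement_16 (n : ℕ) (hn : 3 ≤ n) (a b p : ℝ)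
    (ha0 : 0 ≤ a) (ha : a < ((n : ℝ) - 2) / 2) (hab : a ≤ b) (hb : b < a + 1)
    (hp : p = 2 * (n : ℝ) / ((n : ℝ) - 2 + 2 * (b - a)))
    (c : ℝ) (hc : 0 < c)
    (hceq : c ^ (p - 2) = ((n : ℝ) - 2 * a - 2) ^ 2 / 4) :
    KerBasis (LopCKN n a p (fun _ => c) (sphEval n 0))
      (fun t => Real.cos (((n : ℝ) - 2 * a - 2) * Real.sqrt (p - 2) / 2 * t))
      (fun t => Real.sin (((n : ℝ) - 2 * a - 2) * Real.sqrt (p - 2) / 2 * t)) ∧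
    ∃ σ : ℕ → ℝ,
      (∀ i, 1 ≤ i → σ i = Real.sqrt (sphEval n i - (p - 2) * ((n : ℝ) - 2 * a - 2) ^ 2 / 4)) ∧
      (∀ i, 1 ≤ i → 1 ≤ sphEval n i - (p - 2) * ((n : ℝ) - 2 * a - 2) ^ 2 / 4) ∧
      (∀ i, 1 ≤ i → 0 < σ i) ∧ (∀ i j, 1 ≤ i → i ≤ j → σ i ≤ σ j) ∧
      Tendsto σ atTop atTop ∧
      ∀ i, 1 ≤ i → KerBasis (LopCKN n a p (fun _ => c) (sphEval n i))
        (fun t => Real.exp (-(σ i) * t)) (fun t => Real.exp (σ i * t)) := by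
  have hnR : (3 : ℝ) ≤ n := by exact_mod_cast hn
  have hD : 0 < (n : ℝ) - 2 + 2 * (b - a) := by linarith
  have hp2 : p - 2 = 4 * (1 - (b - a)) / ((n : ℝ) - 2 + 2 * (b - a)) := by
    rw [hp]; field_simp; ring
  have hp2pos : 0 < p - 2 := by
    rw [hp2]; exact div_pos (by linarith) hD
  have hm : 0 < (n : ℝ) - 2 * a - 2 := by linarith
  have hbound : (p - 2) * ((n : ℝ) - 2 * a - 2) ^ 2 / 4 ≤ (n : ℝ) - 2 := by
    have h1 : p - 2 ≤ 4 / ((n : ℝ) - 2) := by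
      rw [hp2, div_le_div_iff₀ hD (by linarith)]
      nlinarith
    have h2 : ((n : ℝ) - 2 * a - 2) ^ 2 ≤ ((n : ℝ) - 2) ^ 2 := by
      apply pow_le_pow_left₀ hm.le; linarith
    have h3 : (p - 2) * ((n : ℝ) - 2 * a - 2) ^ 2 ≤ 4 / ((n : ℝ) - 2) * ((n : ℝ) - 2) ^ 2 :=
      mul_le_mul h1 h2 (sq_nonneg _) (by apply div_nonneg <;> linarith)
    have h4 : 4 / ((n : ℝ) - 2) * ((n : ℝ) - 2) ^ 2 = 4 * ((n : ℝ) - 2) := by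
      have : (n : ℝ) - 2 ≠ 0 := by linarith
      field_simp
    linarith
  have hL : ∀ lam h t, LopCKN n a p (fun _ => c) lam h t
      = -dtt h t + (lam - (p - 2) * ((n : ℝ) - 2 * a - 2) ^ 2 / 4) * h t := by
    intro lam h t
    simp only [LopCKN]
    rw [hceq]; ring
  have hdeg : ∀ i, 1 ≤ i → 1 ≤ sphDeg n i := fun i hi =>
    sphDeg_ge n i 0 hn (by rw [cumHarm_zero n hn]; exact hi)
  have hone : ∀ i, 1 ≤ i → 1 ≤ sphEval n i - (p - 2) * ((n : ℝ) - 2 * a - 2) ^ 2 / 4 := by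
    intro i hi
    have : (1 : ℝ) ≤ sphDeg n i := by exact_mod_cast hdeg i hi
    have : (n : ℝ) - 1 ≤ sphEval n i := by unfold sphEval; nlinarith
    linarith
  have hmono : ∀ i j, i ≤ j → sphEval n i ≤ sphEval n j := by
    intro i j hij
    have h1 : (sphDeg n i : ℝ) ≤ sphDeg n j := by exact_mod_cast sphDeg_mono n hn hij
    have h0 : (0 : ℝ) ≤ sphDeg n i := Nat.cast_nonneg _
    unfold sphEval
    apply mul_le_mul h1 (by linarith) (by linarith) (by linarith)
  have htend : Tendsto (sphEval n) atTop atTop := by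
    rw [Filter.tendsto_atTop]
    intro B
    obtain ⟨N, hN⟩ := exists_nat_ge B
    filter_upwards [eventually_ge_atTop (cumHarm n N)] with i hi
    have h1 : (N : ℝ) + 1 ≤ sphDeg n i := by exact_mod_cast sphDeg_ge n i N hn hi
    have h0 : (0 : ℝ) ≤ N := Nat.cast_nonneg _
    unfold sphEval
    nlinarith
  refine ⟨?_, fun i => Real.sqrt (sphEval n i - (p - 2) * ((n : ℝ) - 2 * a - 2) ^ 2 / 4),
    fun i _ => rfl, hone, ?_, ?_, ?_, ?_⟩
  · have hw : 0 < ((n : ℝ) - 2 * a - 2) * Real.sqrt (p - 2) / 2 := by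
      have := Real.sqrt_pos.2 hp2pos
      positivity
    have hk : sphEval n 0 - (p - 2) * ((n : ℝ) - 2 * a - 2) ^ 2 / 4
        = -(((n : ℝ) - 2 * a - 2) * Real.sqrt (p - 2) / 2) ^ 2 := by
      rw [div_pow, mul_pow, Real.sq_sqrt hp2pos.le]
      simp only [sphEval, sphDeg_zero n hn]
      push_cast; ring
    refine kerBasis_of (hL _) (by fun_prop) (by fun_prop) ?_ ?_ ?_
    · intro t; rw [hk]; exact dtt_cos_lin _ t
    · intro t; rw [hk]; exact dtt_sin_lin _ t
    · rw [deriv_cos_lin, deriv_sin_lin]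
      simpa using hw.ne'
  · intro i hi
    exact Real.sqrt_pos.2 (by linarith [hone i hi])
  · intro i j _ hij
    exact Real.sqrt_le_sqrt (by linarith [hmono i j hij])
  · refine Real.tendsto_sqrt_atTop.comp ?_
    simpa [sub_eq_add_neg] using tendsto_atTop_add_const_right atTop
      (-((p - 2) * ((n : ℝ) - 2 * a - 2) ^ 2 / 4)) htend
  · intro i hi
    have h1 := hone i hi
    have hs := Real.sq_sqrt (show 0 ≤ sphEval n i - (p - 2) * ((n : ℝ) - 2 * a - 2) ^ 2 / 4 by
      linarith)
    have hpos := Real.sqrt_pos.2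
      (show 0 < sphEval n i - (p - 2) * ((n : ℝ) - 2 * a - 2) ^ 2 / 4 by linarith)
    refine kerBasis_of (hL _) (by fun_prop) (by fun_prop) ?_ ?_ ?_
    · intro t; rw [dtt_exp_lin, neg_sq, hs]
    · intro t; rw [dtt_exp_lin, hs]
    · rw [deriv_exp_lin, deriv_exp_lin]
      simp only [mul_zero, Real.exp_zero]
      intro h; linarith
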